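/- arXiv:1504.01903 — 3 statements merged into one kernel-verified Lean document; each statement's English description precedes it below -/
import Mathlib

section
/- Let (Ω, F, (F_t)_{t=0}^T, P) be a complete filtered probability space and h an F-normal integrand on ℝⁿ × Ω with h ≥ m for an integrable m, such that h(·,ω) is convex for P-almost every ω. If the set {x ∈ N : h^∞(x(ω),ω) ≤ 0 P-a.s.} is a linear subspace of the space of adapted strategies, then the problem of minimizing Eh(x) over x ∈ N admits an optimal solution. -/
open Filter MeasureTheory Metric Set
open scoped Topology ENNReal

noncomputable section

/-- Horizon function: g^∞(w) = lim_{δ↓0} inf{ λ g(w'/λ) : 0<λ<δ, |w'-w| ≤ δ }. -/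
def hor {E : Type*} [SeminormedAddCommGroup E] [NormedSpace ℝ E] (g : E → EReal) (w : E) : EReal :=
  ⨆ (δ : ℝ) (_ : 0 < δ), ⨅ (l : ℝ) (_ : l ∈ Set.Ioo (0:ℝ) δ) (w' : E)
      (_ : w' ∈ Metric.closedBall w δ), (l : EReal) * g (l⁻¹ • w')

/-- Positive part of an extended real, as an extended nonnegative real. -/
def ePos (x : EReal) : ℝ≥0∞ := if x = ⊤ then ⊤ else ENNReal.ofReal x.toReal

/-- The extended integral of an EReal-valued function. -/
def eInt {Ω : Type*} [MeasurableSpace Ω] (μ : Measure Ω) (f : Ω → EReal) : EReal :=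
  ((∫⁻ ω, ePos (f ω) ∂μ : ℝ≥0∞) : EReal) + (-((∫⁻ ω, ePos (-(f ω)) ∂μ : ℝ≥0∞) : EReal))

/-- The state space ℝⁿ = ℝ^{n₀} × ⋯ × ℝ^{n_T}. -/
abbrev Strat (T : ℕ) (n : Fin (T+1) → ℕ) := (t : Fin (T+1)) → Fin (n t) → ℝ

/-- Convexity for (−∞,+∞]-valued functions. -/
def EConvexOn {E : Type*} [AddCommGroup E] [Module ℝ E] (g : E → EReal) : Prop :=
  ∀ x y : E, ∀ a b : ℝ, 0 ≤ a → 0 ≤ b → a + b = 1 →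
    g (a • x + b • y) ≤ (a : EReal) * g x + (b : EReal) * g y

/-- A sequence of measurable real functions with values in `[-C, C]` has a measurable random
subsequence converging pointwise to a measurable limit. -/
theorem exists_random_subseq_tendsto {Ω : Type*} {m : MeasurableSpace Ω} (b : ℕ → Ω → ℝ)
    (hb : ∀ k, Measurable (b k)) (C : ℝ) (hC : ∀ k ω, |b k ω| ≤ C) :
    ∃ (l : Ω → ℝ) (σ : ℕ → Ω → ℕ), Measurable l ∧ (∀ k, Measurable (σ k)) ∧
      (∀ k ω, k ≤ σ k ω) ∧ ∀ ω, Tendsto (fun k => b (σ k ω) ω) atTop (𝓝 (l ω)) := by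
  classical
  set l : Ω → ℝ := fun ω => liminf (fun k => b k ω) atTop with hl
  have hlm : Measurable l := Measurable.liminf hb
  have hcl : ∀ k ω, ∃ j, k ≤ j ∧ |b j ω - l ω| < 1 / ((k : ℝ) + 1) := by
    intro k ω
    have hpos : (0 : ℝ) < 1 / ((k : ℝ) + 1) := by positivity
    have hbelow : IsBoundedUnder (· ≥ ·) atTop (fun k => b k ω) :=
      isBoundedUnder_of ⟨-C, fun k => (abs_le.1 (hC k ω)).1⟩
    have habove : IsBoundedUnder (· ≤ ·) atTop (fun k => b k ω) :=
      isBoundedUnder_of ⟨C, fun k => (abs_le.1 (hC k ω)).2⟩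
    have h1 : ∃ᶠ j in atTop, b j ω < l ω + 1 / ((k : ℝ) + 1) :=
      frequently_lt_of_liminf_lt habove.isCoboundedUnder_ge (by simp only [hl]; linarith)
    have h2 : ∀ᶠ j in atTop, l ω - 1 / ((k : ℝ) + 1) < b j ω :=
      eventually_lt_of_lt_liminf (by simp only [hl]; linarith) hbelow
    obtain ⟨j, hj1, hj2, hj3⟩ := (h1.and_eventually (h2.and (eventually_ge_atTop k))).exists
    exact ⟨j, hj3, abs_lt.2 ⟨by linarith, by linarith⟩⟩
  refine ⟨l, fun k ω => Nat.find (hcl k ω), hlm, fun k => ?_, fun k ω => ?_, fun ω => ?_⟩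
  · refine measurable_find _ fun j => ?_
    refine (MeasurableSet.const _).inter ?_
    exact measurableSet_lt ((hb j).sub hlm).abs measurable_const
  · exact (Nat.find_spec (hcl k ω)).1
  · rw [tendsto_iff_dist_tendsto_zero]
    refine squeeze_zero (fun _ => dist_nonneg) (fun k => ?_)
      (tendsto_one_div_add_atTop_nhds_zero_nat (𝕜 := ℝ))
    exact (Nat.find_spec (hcl k ω)).2.le

theorem Measurable.random_subseq {Ω : Type*} {m : MeasurableSpace Ω} {b : ℕ → Ω → ℝ} {σ : Ω → ℕ}
    (hb : ∀ k, Measurable (b k)) (hσ : Measurable σ) : Measurable fun ω => b (σ ω) ω :=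
  (measurable_from_prod_countable_left (f := fun p : Ω × ℕ => b p.2 p.1) hb).comp
    (measurable_id.prodMk hσ)

/-- Closedness in the coordinates of the random closed convex cones `K ω`, when the adapted
directions in the cones form a symmetric set. -/
theorem exists_adapted_limit_aux {Ω ι κ P : Type*} {m0 : MeasurableSpace Ω} (μ : Measure Ω)
    [Fintype ι] [DecidableEq ι] [LinearOrder κ] (τ : ι → κ) (F : κ → MeasurableSpace Ω)
    (hF : Monotone F) [AddCommGroup P] [Module ℝ P] [TopologicalSpace P] [ContinuousSMul ℝ P]
    (K : Ω → Set ((ι → ℝ) × P)) (hcl : ∀ ω, IsClosed (K ω))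
    (hsm : ∀ ω, ∀ c : ℝ, 0 < c → ∀ z ∈ K ω, c • z ∈ K ω)
    (h0 : ∀ᵐ ω ∂μ, (0 : (ι → ℝ) × P) ∈ K ω)
    (hadd : ∀ᵐ ω ∂μ, ∀ z ∈ K ω, ∀ w ∈ K ω, z + w ∈ K ω)
    (hneg : ∀ x : ι → Ω → ℝ, (∀ i, Measurable[F (τ i)] (x i)) →
      (∀ᵐ ω ∂μ, ((fun i => x i ω), (0 : P)) ∈ K ω) →
      ∀ᵐ ω ∂μ, ((fun i => -x i ω), (0 : P)) ∈ K ω)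
    (S : Finset ι) : ∀ (x : ℕ → ι → Ω → ℝ) (p : ℕ → Ω → P) (y : ι → Ω → ℝ) (q : Ω → P),
      (∀ k, ∀ i ∈ S, Measurable[F (τ i)] (x k i)) →
      (∀ i ∉ S, ∀ᵐ ω ∂μ, Tendsto (fun k => x k i ω) atTop (𝓝 (y i ω))) →
      (∀ᵐ ω ∂μ, Tendsto (fun k => p k ω) atTop (𝓝 (q ω))) →
      (∀ k, ∀ᵐ ω ∂μ, ((fun i => x k i ω), p k ω) ∈ K ω) →
      ∃ z : ι → Ω → ℝ, (∀ i ∈ S, Measurable[F (τ i)] (z i)) ∧ (∀ i ∉ S, z i = y i) ∧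
        ∀ᵐ ω ∂μ, ((fun i => z i ω), q ω) ∈ K ω := by
  induction hn : S.card generalizing S with
  | zero =>
    obtain rfl := Finset.card_eq_zero.1 hn
    intro x p y q _ hy hq hK
    refine ⟨y, by simp, by simp, ?_⟩
    filter_upwards [ae_all_iff.2 fun i => hy i (by simp), hq, ae_all_iff.2 hK] with ω h1 h2 h3
    exact (hcl ω).mem_of_tendsto ((tendsto_pi_nhds.2 h1).prodMk_nhds h2) (.of_forall h3)
  | succ N ih =>
    intro x p y q hx hy hq hK
    have hne : S.Nonempty := Finset.card_pos.1 (by omega)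
    obtain ⟨i, hi, hmin⟩ := S.exists_min_image τ hne
    have hcard : (S.erase i).card = N := by rw [Finset.card_erase_of_mem hi]; omega
    have hle : ∀ j ∈ S.erase i, F (τ i) ≤ F (τ j) := fun j hj =>
      hF (hmin j (Finset.mem_of_mem_erase hj))
    have hnot : ∀ j, j ∉ S.erase i → j ≠ i → j ∉ S := fun j hj hji hjS =>
      hj (Finset.mem_erase.2 ⟨hji, hjS⟩)
    obtain ⟨l, σ, hl, hσ, hσk, hσl⟩ := exists_random_subseq_tendsto (m := F (τ i))
      (fun k ω => Real.arctan (x k i ω)) (fun k => Real.measurable_arctan.comp (hx k i hi))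
      (Real.pi / 2) (fun k ω => abs_le.2 ⟨(Real.neg_pi_div_two_lt_arctan _).le,
        (Real.arctan_lt_pi_div_two _).le⟩)
    have hσtop : ∀ ω, Tendsto (fun k => σ k ω) atTop atTop := fun ω =>
      tendsto_atTop_mono (fun k => hσk k ω) tendsto_id
    have hxi : ∀ k, Measurable[F (τ i)] fun ω => x (σ k ω) i ω := fun k =>
      Measurable.random_subseq (m := F (τ i)) (b := fun k => x k i) (fun k => hx k i hi) (hσ k)
    have hxj : ∀ k, ∀ j ∈ S.erase i, Measurable[F (τ j)] fun ω => x (σ k ω) j ω := fun k j hj =>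
      Measurable.random_subseq (m := F (τ j)) (b := fun k => x k j)
        (fun k => hx k j (Finset.mem_of_mem_erase hj)) ((hσ k).mono (hle j hj) le_rfl)
    have hB : MeasurableSet[F (τ i)] {ω | Real.cos (l ω) = 0} :=
      (Real.measurable_cos.comp hl) (measurableSet_singleton 0)
    have hcosm : ∀ k, Measurable[F (τ i)] fun ω => Real.cos (Real.arctan (x (σ k ω) i ω)) :=
      fun k => Real.measurable_cos.comp (Real.measurable_arctan.comp (hxi k))
    have hcos : ∀ ω, Tendsto (fun k => Real.cos (Real.arctan (x (σ k ω) i ω))) atTop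
        (𝓝 (Real.cos (l ω))) := fun ω => (Real.continuous_cos.tendsto _).comp (hσl ω)
    have hsin : ∀ ω, Tendsto (fun k => Real.sin (Real.arctan (x (σ k ω) i ω))) atTop
        (𝓝 (Real.sin (l ω))) := fun ω => (Real.continuous_sin.tendsto _).comp (hσl ω)
    have hyσ : ∀ j ∉ S, ∀ᵐ ω ∂μ, Tendsto (fun k => x (σ k ω) j ω) atTop (𝓝 (y j ω)) := by
      intro j hj
      filter_upwards [hy j hj] with ω hω using hω.comp (hσtop ω)
    have hqσ : ∀ᵐ ω ∂μ, Tendsto (fun k => p (σ k ω) ω) atTop (𝓝 (q ω)) := by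
      filter_upwards [hq] with ω hω using hω.comp (hσtop ω)
    have hKσ : ∀ᵐ ω ∂μ, ∀ k, ((fun j => x (σ k ω) j ω), p (σ k ω) ω) ∈ K ω := by
      filter_upwards [ae_all_iff.2 hK] with ω hω k using hω _
    classical
    -- the direction along which the `i`-th coordinate blows up
    obtain ⟨G, hGm, hGy, hGK⟩ := ih (S.erase i) hcard
      (fun k j ω => if Real.cos (l ω) = 0 then
        Real.cos (Real.arctan (x (σ k ω) i ω)) * x (σ k ω) j ω else 0)
      (fun k ω => if Real.cos (l ω) = 0 then
        Real.cos (Real.arctan (x (σ k ω) i ω)) • p (σ k ω) ω else 0)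
      (fun j ω => if j = i then (if Real.cos (l ω) = 0 then Real.sin (l ω) else 0) else 0)
      (fun _ => 0)
      (fun k j hj => Measurable.ite (hle j hj _ hB)
        (((hcosm k).mono (hle j hj) le_rfl).mul (hxj k j hj)) measurable_const)
      (by
        intro j hj
        by_cases hji : j = i
        · subst hji
          refine .of_forall fun ω => ?_
          by_cases hω : Real.cos (l ω) = 0
          · simp only [hω, if_true]
            refine (hsin ω).congr fun k => ?_
            rw [← Real.tan_mul_cos (Real.cos_arctan_pos _).ne', Real.tan_arctan, mul_comm]
          · simp [hω]
        · filter_upwards [hyσ j (hnot j hj hji)] with ω hω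
          by_cases hc : Real.cos (l ω) = 0
          · simpa [hc, hji] using (hcos ω).mul hω
          · simp [hc, hji])
      (by
        filter_upwards [hqσ] with ω hω
        by_cases hc : Real.cos (l ω) = 0
        · simpa [hc] using (hcos ω).smul hω
        · simp only [hc, if_false]
          exact tendsto_const_nhds)
      (by
        intro k
        filter_upwards [hKσ, h0] with ω hω hω0
        by_cases hc : Real.cos (l ω) = 0
        · simpa [hc, Prod.smul_mk, Pi.smul_def] using
            hsm ω _ (Real.cos_arctan_pos (x (σ k ω) i ω)) _ (hω k)
        · simp only [hc, if_false]
          exact hω0)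
    have hii : i ∉ S.erase i := by simp
    have hGi : ∀ ω, G i ω = if Real.cos (l ω) = 0 then Real.sin (l ω) else 0 := fun ω => by
      rw [hGy i hii]; simp
    have hGj : ∀ j ∉ S, ∀ ω, G j ω = 0 := by
      intro j hj ω
      have hji : j ≠ i := fun h => hj (h ▸ hi)
      rw [hGy j (fun h => hj (Finset.mem_of_mem_erase h))]; simp [hji]
    have hGim : Measurable[F (τ i)] (G i) := by
      have : G i = fun ω => if Real.cos (l ω) = 0 then Real.sin (l ω) else 0 := funext hGi
      rw [this]
      exact Measurable.ite hB (Real.measurable_sin.comp hl) measurable_const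
    have hGall : ∀ j, Measurable[F (τ j)] (G j) := by
      intro j
      by_cases hj : j ∈ S.erase i
      · exact hGm j hj
      by_cases hji : j = i
      · exact hji ▸ hGim
      · have : G j = fun _ => 0 := funext (hGj j (hnot j hj hji))
        rw [this]; exact measurable_const
    have hGneg := hneg G hGall hGK
    have hGc : ∀ᵐ ω ∂μ, ∀ c : ℝ, ((fun j => c * G j ω), (0 : P)) ∈ K ω := by
      filter_upwards [hGK, hGneg, h0] with ω h1 h2 h3 c
      rcases lt_trichotomy c 0 with hc | rfl | hc
      · simpa [Prod.smul_mk, Pi.smul_def, Pi.neg_def] using hsm ω (-c) (neg_pos.2 hc) _ h2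
      · simp only [zero_mul]
        exact h3
      · simpa [Prod.smul_mk, Pi.smul_def] using hsm ω c hc _ h1
    obtain ⟨z, hzm, hzy, hzK⟩ := ih (S.erase i) hcard
      (fun k j ω => x (σ k ω) j ω + -(x (σ k ω) i ω / G i ω) * G j ω)
      (fun k ω => p (σ k ω) ω)
      (Function.update y i (fun ω => Real.sin (l ω) / Real.cos (l ω))) q
      (fun k j hj => (hxj k j hj).add ((((hxi k).div hGim).neg.mono (hle j hj) le_rfl).mul
        (hGall j)))
      (by
        intro j hj
        by_cases hji : j = i
        · subst hji
          refine .of_forall fun ω => ?_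
          simp only [Function.update_self]
          by_cases hc : Real.cos (l ω) = 0
          · have hs : G j ω ≠ 0 := by
              rw [hGi, if_pos hc]
              intro hs
              have := Real.sin_sq_add_cos_sq (l ω)
              rw [hs, hc] at this
              norm_num at this
            have : ∀ k, x (σ k ω) j ω + -(x (σ k ω) j ω / G j ω) * G j ω = 0 := fun k => by
              field_simp; ring
            simp only [this, hc, div_zero]
            exact tendsto_const_nhds
          · have hs : G j ω = 0 := by rw [hGi, if_neg hc]
            simp only [hs, mul_zero, add_zero]
            refine ((hsin ω).div (hcos ω) hc).congr fun k => ?_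
            simp only [Pi.div_apply]
            rw [← Real.tan_eq_sin_div_cos, Real.tan_arctan]
        · rw [Function.update_of_ne hji]
          filter_upwards [hyσ j (hnot j hj hji)] with ω hω
          simpa [hGj j (hnot j hj hji) ω] using hω)
      hqσ
      (by
        intro k
        filter_upwards [hKσ, hGc, hadd] with ω h1 h2 h3
        simpa [Pi.add_def] using h3 _ (h1 k) _ (h2 (-(x (σ k ω) i ω / G i ω))))
    refine ⟨z, fun j hj => ?_, fun j hj => ?_, hzK⟩
    · by_cases hji : j = i
      · subst hji
        rw [hzy j hii, Function.update_self]
        exact (Real.measurable_sin.comp hl).div (Real.measurable_cos.comp hl)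
      · exact hzm j (Finset.mem_erase.2 ⟨hji, hj⟩)
    · have hji : j ≠ i := fun h => hj (h ▸ hi)
      rw [hzy j (fun h => hj (Finset.mem_of_mem_erase h)), Function.update_of_ne hji]

theorem norm_toLp_two_sq {Ω : Type*} {m0 : MeasurableSpace Ω} {μ : Measure Ω} {w : Ω → ℝ}
    (hw : MemLp w 2 μ) : ‖hw.toLp w‖ ^ 2 = ∫ ω, w ω ^ 2 ∂μ := by
  rw [← real_inner_self_eq_norm_sq, L2.inner_def]
  refine integral_congr_ae ?_
  filter_upwards [hw.coeFn_toLp] with ω hω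
  rw [hω, real_inner_self_eq_norm_sq, Real.norm_eq_abs, sq_abs]

/-- If the integrals of nonnegative functions `v k` are bounded by a convergent sequence and
`exp (-v k / 2)` converges a.e., then `v k` converges a.e. to an integrable function. -/
theorem exists_tendsto_of_tendsto_exp {Ω : Type*} {m0 : MeasurableSpace Ω} {μ : Measure Ω}
    {v : ℕ → Ω → ℝ} (hv : ∀ k, Integrable (v k) μ) (hpos : ∀ k, 0 ≤ᵐ[μ] v k)
    {α : ℕ → ℝ} {a : ℝ} (hα : Tendsto α atTop (𝓝 a)) (hle : ∀ k, ∫ ω, v k ω ∂μ ≤ α k)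
    {u : Ω → ℝ} (hu : ∀ᵐ ω ∂μ, Tendsto (fun k => Real.exp (-v k ω / 2)) atTop (𝓝 (u ω))) :
    ∃ V : Ω → ℝ, Integrable V μ ∧ (∀ᵐ ω ∂μ, Tendsto (fun k => v k ω) atTop (𝓝 (V ω))) ∧
      ∫ ω, V ω ∂μ ≤ a := by
  have ha : 0 ≤ a := ge_of_tendsto' hα fun k => (integral_nonneg_of_ae (hpos k)).trans (hle k)
  have hfatou : ∫⁻ ω, liminf (fun k => ENNReal.ofReal (v k ω)) atTop ∂μ ≤ ENNReal.ofReal a := by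
    refine (lintegral_liminf_le' fun k => (hv k).1.aemeasurable.ennreal_ofReal).trans ?_
    have h1 : ∀ k, ∫⁻ ω, ENNReal.ofReal (v k ω) ∂μ ≤ ENNReal.ofReal (α k) := fun k => by
      rw [← ofReal_integral_eq_lintegral_ofReal (hv k) (hpos k)]
      exact ENNReal.ofReal_le_ofReal (hle k)
    exact (liminf_le_liminf (.of_forall h1)).trans
      ((ENNReal.continuous_ofReal.tendsto a).comp hα).liminf_eq.le
  have hfin : ∀ᵐ ω ∂μ, liminf (fun k => ENNReal.ofReal (v k ω)) atTop < ∞ := by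
    refine ae_lt_top' ?_ (hfatou.trans_lt ENNReal.ofReal_lt_top).ne
    have hmk := fun k => (hv k).1.aemeasurable.ennreal_ofReal
    refine ⟨_, Measurable.liminf fun k => (hmk k).measurable_mk, ?_⟩
    filter_upwards [ae_all_iff.2 fun k => (hmk k).ae_eq_mk] with ω hω
    simp only [hω]
  have hlim : ∀ᵐ ω ∂μ, Tendsto (fun k => v k ω) atTop (𝓝 (-2 * Real.log (u ω))) := by
    filter_upwards [hu, hfin] with ω h1 h2
    obtain ⟨M, hM, hM'⟩ := exists_between h2
    have hfr := frequently_lt_of_liminf_lt (by isBoundedDefault) hM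
    have hupos : 0 < u ω := by
      refine (Real.exp_pos (-M.toReal / 2)).trans_le ?_
      refine ge_of_tendsto_of_frequently h1 (hfr.mono fun k hk => ?_)
      have : v k ω ≤ M.toReal := (ENNReal.ofReal_le_iff_le_toReal hM'.ne).1 hk.le
      exact Real.exp_le_exp.2 (by linarith)
    refine ((Real.continuousAt_log hupos.ne').tendsto.comp h1 |>.const_mul (-2)).congr fun k => ?_
    simp only [Function.comp_apply, Real.log_exp]
    ring
  have hVpos : 0 ≤ᵐ[μ] fun ω => -2 * Real.log (u ω) := by
    filter_upwards [hlim, ae_all_iff.2 hpos] with ω h1 h2 using ge_of_tendsto' h1 h2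
  have hVm : AEStronglyMeasurable (fun ω => -2 * Real.log (u ω)) μ :=
    aestronglyMeasurable_of_tendsto_ae atTop (fun k => (hv k).1) hlim
  have hVle : ∫⁻ ω, ENNReal.ofReal (-2 * Real.log (u ω)) ∂μ ≤ ENNReal.ofReal a := by
    refine le_trans (lintegral_mono_ae ?_) hfatou
    filter_upwards [hlim] with ω h1
    exact ((ENNReal.continuous_ofReal.tendsto _).comp h1).liminf_eq.ge
  refine ⟨fun ω => -2 * Real.log (u ω), ⟨hVm, ?_⟩, hlim, ?_⟩
  · rw [hasFiniteIntegral_iff_ofReal hVpos]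
    exact hVle.trans_lt ENNReal.ofReal_lt_top
  · rw [integral_eq_lintegral_of_nonneg_ae hVpos hVm]
    exact ENNReal.toReal_le_of_le_ofReal ha hVle

/-- A Komlós type principle: decreasing sequences of midpoint convex sets of integrable functions,
bounded below by an integrable function and bounded in mean, admit an a.e. convergent selection. -/
theorem exists_ae_tendsto_of_midpoint_closed {Ω : Type*} {m0 : MeasurableSpace Ω} {μ : Measure Ω}
    [IsProbabilityMeasure μ] {m : Ω → ℝ} (hm : Integrable m μ) {C : ℕ → Set (Ω → ℝ)}
    (hanti : Antitone C) (hne : ∀ k, (C k).Nonempty)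
    (hmid : ∀ k, ∀ f ∈ C k, ∀ g ∈ C k, (fun ω => (f ω + g ω) / 2) ∈ C k)
    (hint : ∀ k, ∀ f ∈ C k, Integrable f μ) (hbd : ∀ k, ∀ f ∈ C k, m ≤ᵐ[μ] f)
    {α : ℕ → ℝ} {a : ℝ} (hα : Tendsto α atTop (𝓝 a)) (hle : ∀ k, ∀ f ∈ C k, ∫ ω, f ω ∂μ ≤ α k) :
    ∃ g : ℕ → Ω → ℝ, (∀ k, g k ∈ C k) ∧ ∃ G : Ω → ℝ, Integrable G μ ∧
      (∀ᵐ ω ∂μ, Tendsto (fun k => g k ω) atTop (𝓝 (G ω))) ∧ ∫ ω, G ω ∂μ ≤ a := by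
  set J : (Ω → ℝ) → ℝ := fun f => ∫ ω, Real.exp (m ω - f ω) ∂μ with hJ
  have hJint : ∀ k, ∀ f ∈ C k, Integrable (fun ω => Real.exp (m ω - f ω)) μ := by
    intro k f hf
    refine Integrable.of_bound (C := 1)
      (Real.continuous_exp.comp_aestronglyMeasurable (hm.1.sub (hint k f hf).1)) ?_
    filter_upwards [hbd k f hf] with ω hω
    rw [Real.norm_eq_abs, abs_of_pos (Real.exp_pos _)]
    exact Real.exp_le_one_iff.2 (by linarith)
  have hJ0 : ∀ f, 0 ≤ J f := fun f => integral_nonneg fun ω => (Real.exp_pos _).le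
  have hJ1 : ∀ k, ∀ f ∈ C k, J f ≤ 1 := by
    intro k f hf
    have : J f ≤ ∫ _, (1 : ℝ) ∂μ := by
      refine integral_mono_ae (hJint k f hf) (integrable_const _) ?_
      filter_upwards [hbd k f hf] with ω hω
      exact Real.exp_le_one_iff.2 (by linarith)
    simpa using this
  have hbb : ∀ k, BddBelow (J '' C k) := fun k => ⟨0, by rintro _ ⟨f, _, rfl⟩; exact hJ0 f⟩
  set I : ℕ → ℝ := fun k => sInf (J '' C k) with hI
  have hImono : Monotone I := fun k j hkj =>
    csInf_le_csInf (hbb k) ((hne j).image J) (image_mono (hanti hkj))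
  have hIle : ∀ k, ∀ f ∈ C k, I k ≤ J f := fun k f hf => csInf_le (hbb k) ⟨f, hf, rfl⟩
  have hI1 : BddAbove (range I) := by
    refine ⟨1, ?_⟩
    rintro _ ⟨k, rfl⟩
    obtain ⟨f, hf⟩ := hne k
    exact (hIle k f hf).trans (hJ1 k f hf)
  have hIlim : Tendsto I atTop (𝓝 (⨆ k, I k)) := tendsto_atTop_ciSup hImono hI1
  have hsel : ∀ k : ℕ, ∃ f ∈ C k, J f < I k + 1 / ((k : ℝ) + 1) := by
    intro k
    obtain ⟨_, ⟨f, hf, rfl⟩, h⟩ := exists_lt_of_csInf_lt ((hne k).image J)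
      (show sInf (J '' C k) < I k + 1 / ((k : ℝ) + 1) from lt_add_of_pos_right _ (by positivity))
    exact ⟨f, hf, h⟩
  choose g hg hgJ using hsel
  have hu : ∀ k, MemLp (fun ω => Real.exp ((m ω - g k ω) / 2)) 2 μ := by
    intro k
    refine MemLp.of_bound (Real.continuous_exp.comp_aestronglyMeasurable
      (((hm.sub (hint k _ (hg k))).div_const 2).1)) 1 ?_
    filter_upwards [hbd k _ (hg k)] with ω hω
    rw [Real.norm_eq_abs, abs_of_pos (Real.exp_pos _)]
    exact Real.exp_le_one_iff.2 (by linarith)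
  have hkey : ∀ k j, k ≤ j → dist ((hu k).toLp _) ((hu j).toLp _) ≤
      √(((⨆ k, I k) - I k) + 2 * (1 / ((k : ℝ) + 1))) := by
    intro k j hkj
    have hgj : g j ∈ C k := hanti hkj (hg j)
    refine Real.le_sqrt_of_sq_le ?_
    rw [dist_eq_norm, ← MemLp.toLp_sub, norm_toLp_two_sq]
    have hexp : ∀ ω, ((fun ω => Real.exp ((m ω - g k ω) / 2)) -
        fun ω => Real.exp ((m ω - g j ω) / 2)) ω ^ 2 = Real.exp (m ω - g k ω) +
        Real.exp (m ω - g j ω) - 2 * Real.exp (m ω - (g k ω + g j ω) / 2) := by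
      intro ω
      have e1 : Real.exp (m ω - g k ω) = Real.exp ((m ω - g k ω) / 2) ^ 2 := by
        rw [← Real.exp_nat_mul]; congr 1; push_cast; ring
      have e2 : Real.exp (m ω - g j ω) = Real.exp ((m ω - g j ω) / 2) ^ 2 := by
        rw [← Real.exp_nat_mul]; congr 1; push_cast; ring
      have e3 : Real.exp (m ω - (g k ω + g j ω) / 2) =
          Real.exp ((m ω - g k ω) / 2) * Real.exp ((m ω - g j ω) / 2) := by
        rw [← Real.exp_add]; congr 1; ring
      simp only [Pi.sub_apply]
      rw [e1, e2, e3]; ring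
    simp only [hexp]
    have hmidk := hmid k _ (hg k) _ hgj
    rw [integral_sub (f := fun ω => Real.exp (m ω - g k ω) + Real.exp (m ω - g j ω))
        ((hJint k _ (hg k)).add (hJint k _ hgj)) ((hJint k _ hmidk).const_mul 2),
      integral_add (hJint k _ (hg k)) (hJint k _ hgj), integral_const_mul]
    have h1 := hIle k _ hmidk
    have h2 := hgJ k
    have h3 := hgJ j
    have h4 : I j ≤ ⨆ k, I k := le_ciSup hI1 j
    have h5 : 1 / ((j : ℝ) + 1) ≤ 1 / ((k : ℝ) + 1) := one_div_le_one_div_of_le (by positivity)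
      (by exact_mod_cast Nat.succ_le_succ hkj)
    simp only [hJ] at h1 h2 h3
    linarith
  have hcau : CauchySeq fun k => (hu k).toLp _ := by
    refine cauchySeq_of_le_tendsto_0' _ hkey ?_
    have h1 := ((tendsto_const_nhds (x := ⨆ k, I k)).sub hIlim).add
      ((tendsto_one_div_add_atTop_nhds_zero_nat (𝕜 := ℝ)).const_mul 2)
    simpa [Function.comp_def] using (Real.continuous_sqrt.tendsto _).comp h1
  obtain ⟨U, hU⟩ := cauchySeq_tendsto_of_complete hcau
  obtain ⟨ns, hns, hnsU⟩ := (tendstoInMeasure_of_tendsto_Lp hU).exists_seq_tendsto_ae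
  have hlim : ∀ᵐ ω ∂μ, Tendsto (fun k => Real.exp (-(g (ns k) ω - m ω) / 2)) atTop (𝓝 (U ω)) := by
    filter_upwards [hnsU, ae_all_iff.2 fun k => (hu k).coeFn_toLp] with ω h1 h2
    refine h1.congr fun k => ?_
    rw [h2, neg_sub]
  obtain ⟨V, hV, hVlim, hVle⟩ := exists_tendsto_of_tendsto_exp (μ := μ)
    (v := fun k ω => g (ns k) ω - m ω) (fun k => (hint _ _ (hg _)).sub hm)
    (fun k => by
      filter_upwards [hbd _ _ (hg (ns k))] with ω hω
      simpa using hω)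
    ((hα.comp hns.tendsto_atTop).sub_const (∫ ω, m ω ∂μ))
    (fun k => by
      rw [integral_sub (hint _ _ (hg _)) hm]
      exact sub_le_sub_right (hle _ _ (hg _)) _) hlim
  refine ⟨fun k => g (ns k), fun k => hanti (hns.le_apply) (hg _), fun ω => V ω + m ω,
    hV.add hm, ?_, ?_⟩
  · filter_upwards [hVlim] with ω hω
    simpa using hω.add_const (m ω)
  · rw [integral_add hV hm]
    linarith

theorem measurable_pi_of_forall {Ω ι : Type*} {m : MeasurableSpace Ω} {f : Ω → ι → ℝ}
    (hf : ∀ i, Measurable[m] fun ω => f ω i) : Measurable[m] f :=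
  measurable_pi_lambda _ hf

theorem ePos_mono : Monotone ePos := fun _ _ h => EReal.toENNReal_le_toENNReal h

theorem eInt_mono_ae {Ω : Type*} {m0 : MeasurableSpace Ω} {μ : Measure Ω} {f g : Ω → EReal}
    (h : f ≤ᵐ[μ] g) : eInt μ f ≤ eInt μ g := by
  refine add_le_add ?_ (EReal.neg_le_neg_iff.2 ?_)
  · exact EReal.coe_ennreal_le_coe_ennreal_iff.2 (lintegral_mono_ae (h.mono fun _ h => ePos_mono h))
  · exact EReal.coe_ennreal_le_coe_ennreal_iff.2
      (lintegral_mono_ae (h.mono fun _ h => ePos_mono (EReal.neg_le_neg_iff.2 h)))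

theorem ePos_coe (r : ℝ) : ePos (r : EReal) = ENNReal.ofReal r := by
  simp [ePos]

theorem eInt_coe {Ω : Type*} {m0 : MeasurableSpace Ω} {μ : Measure Ω} {f : Ω → ℝ}
    (hf : Integrable f μ) : eInt μ (fun ω => (f ω : EReal)) = ((∫ ω, f ω ∂μ : ℝ) : EReal) := by
  have h1 : ∫⁻ ω, ENNReal.ofReal (f ω) ∂μ ≠ ∞ := hf.lintegral_lt_top.ne
  have h2 : ∫⁻ ω, ENNReal.ofReal (-f ω) ∂μ ≠ ∞ := hf.neg.lintegral_lt_top.ne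
  simp only [eInt, ← EReal.coe_neg, ePos_coe]
  rw [integral_eq_lintegral_pos_part_sub_lintegral_neg_part hf, EReal.coe_sub, sub_eq_add_neg,
    EReal.coe_ennreal_toReal h1, EReal.coe_ennreal_toReal h2]

theorem exists_integrable_of_eInt_lt_top {Ω : Type*} {m0 : MeasurableSpace Ω} {μ : Measure Ω}
    {H : Ω → EReal} (hH : Measurable H) {m : Ω → ℝ} (hm : Integrable m μ)
    (hbd : ∀ ω, (m ω : EReal) ≤ H ω) (hfin : eInt μ H < ⊤) :
    ∃ f : Ω → ℝ, Integrable f μ ∧ H =ᵐ[μ] fun ω => (f ω : EReal) := by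
  have hneg : ∫⁻ ω, ePos (-H ω) ∂μ ≤ ∫⁻ ω, ENNReal.ofReal (-m ω) ∂μ := by
    refine lintegral_mono fun ω => ?_
    rw [← ePos_coe, EReal.coe_neg]
    exact ePos_mono (EReal.neg_le_neg_iff.2 (hbd ω))
  have hneg' : ∫⁻ ω, ePos (-H ω) ∂μ < ∞ := hneg.trans_lt hm.neg.lintegral_lt_top
  have hpos : ∫⁻ ω, ePos (H ω) ∂μ ≠ ∞ := by
    intro htop
    rw [eInt, htop, EReal.coe_ennreal_top, EReal.top_add_of_ne_bot] at hfin
    · exact lt_irrefl _ hfin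
    · rw [Ne, EReal.neg_eq_bot_iff, EReal.coe_ennreal_eq_top_iff]
      exact hneg'.ne
  have hePos : Measurable fun ω => ePos (H ω) := measurable_ereal_toENNReal.comp hH
  have htop : ∀ᵐ ω ∂μ, H ω ≠ ⊤ := by
    filter_upwards [ae_lt_top hePos hpos] with ω hω htop
    simp [ePos, htop] at hω
  have hbot : ∀ ω, H ω ≠ ⊥ := fun ω h => by simpa [h] using hbd ω
  have heq : H =ᵐ[μ] fun ω => ((H ω).toReal : EReal) := by
    filter_upwards [htop] with ω hω
    exact (EReal.coe_toReal hω (hbot ω)).symm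
  refine ⟨fun ω => (H ω).toReal, ⟨hH.ereal_toReal.aestronglyMeasurable, ?_⟩, heq⟩
  rw [hasFiniteIntegral_iff_norm]
  refine lt_of_le_of_lt (b := ∫⁻ ω, (ePos (H ω) + ePos (-H ω)) ∂μ) (lintegral_mono_ae ?_) ?_
  · filter_upwards [heq] with ω hω
    rw [hω, ← EReal.coe_neg, ePos_coe, ePos_coe, EReal.toReal_coe, Real.norm_eq_abs]
    rcases abs_cases (H ω).toReal with ⟨h, _⟩ | ⟨h, _⟩ <;> rw [h]
    · exact le_self_add
    · exact le_add_self
  · rw [lintegral_add_left hePos]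
    exact ENNReal.add_lt_top.2 ⟨hpos.lt_top, hneg'⟩

theorem EReal.le_coe_div_iff {l c : ℝ} (hl : 0 < l) (g : EReal) :
    g ≤ ((c / l : ℝ) : EReal) ↔ (l : EReal) * g ≤ c := by
  induction g with
  | bot => simp [EReal.coe_mul_bot_of_pos hl]
  | top => simp [EReal.coe_mul_top_of_pos hl]
  | coe r =>
    rw [← EReal.coe_mul, EReal.coe_le_coe_iff, EReal.coe_le_coe_iff, le_div_iff₀ hl, mul_comm]

/-- The cone generated by the epigraph of `g`, placed at height one. -/
def perspCone {E : Type*} [AddCommGroup E] [Module ℝ E] (g : E → EReal) : Set (E × ℝ × ℝ) :=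
  {p | 0 < p.2.1 ∧ g (p.2.1⁻¹ • p.1) ≤ ((p.2.2 / p.2.1 : ℝ) : EReal)}

section PerspCone

variable {E : Type*} [NormedAddCommGroup E] [NormedSpace ℝ E] {g : E → EReal}

theorem smul_mem_perspCone {c : ℝ} (hc : 0 < c) {z : E × ℝ × ℝ} (hz : z ∈ perspCone g) :
    c • z ∈ perspCone g := by
  obtain ⟨h1, h2⟩ := hz
  refine ⟨mul_pos hc h1, ?_⟩
  have e1 : (c * z.2.1)⁻¹ • c • z.1 = z.2.1⁻¹ • z.1 := by
    rw [smul_smul]; congr 1; field_simp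
  have e2 : c * z.2.2 / (c * z.2.1) = z.2.2 / z.2.1 := by field_simp
  change g ((c * z.2.1)⁻¹ • c • z.1) ≤ ((c * z.2.2 / (c * z.2.1) : ℝ) : EReal)
  rwa [e1, e2]

theorem EConvexOn.add_mem_perspCone (hg : EConvexOn g) {z w : E × ℝ × ℝ} (hz : z ∈ perspCone g)
    (hw : w ∈ perspCone g) : z + w ∈ perspCone g := by
  obtain ⟨x, l, c⟩ := z
  obtain ⟨y, k, d⟩ := w
  obtain ⟨hl, h1⟩ := hz
  obtain ⟨hk, h2⟩ := hw
  simp only at hl h1 hk h2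
  have hlk : 0 < l + k := add_pos hl hk
  refine ⟨hlk, ?_⟩
  have e : (l + k)⁻¹ • (x + y) = (l / (l + k)) • l⁻¹ • x + (k / (l + k)) • k⁻¹ • y := by
    rw [smul_smul, smul_smul, smul_add]
    congr 2 <;> field_simp
  have ha : 0 ≤ l / (l + k) := by positivity
  have hb : 0 ≤ k / (l + k) := by positivity
  have h := hg (l⁻¹ • x) (k⁻¹ • y) (l / (l + k)) (k / (l + k)) ha hb (by field_simp)
  simp only [Prod.mk_add_mk]
  rw [e]
  refine h.trans ((add_le_add (mul_le_mul_of_nonneg_left h1 (EReal.coe_nonneg.2 ha))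
    (mul_le_mul_of_nonneg_left h2 (EReal.coe_nonneg.2 hb))).trans_eq ?_)
  rw [← EReal.coe_mul, ← EReal.coe_mul, ← EReal.coe_add]
  congr 1
  field_simp

theorem smul_mem_closure_perspCone {c : ℝ} (hc : 0 < c) {z : E × ℝ × ℝ}
    (hz : z ∈ closure (perspCone g)) : c • z ∈ closure (perspCone g) :=
  map_mem_closure (continuous_const_smul c) hz fun _ => smul_mem_perspCone hc

theorem EConvexOn.add_mem_closure_perspCone (hg : EConvexOn g) {z w : E × ℝ × ℝ}
    (hz : z ∈ closure (perspCone g)) (hw : w ∈ closure (perspCone g)) :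
    z + w ∈ closure (perspCone g) :=
  map_mem_closure₂ continuous_add hz hw fun _ h1 _ h2 => hg.add_mem_perspCone h1 h2

theorem LowerSemicontinuous.le_of_mem_closure_perspCone (hg : LowerSemicontinuous g) {x : E} {c : ℝ}
    (h : (x, (1 : ℝ), c) ∈ closure (perspCone g)) : g x ≤ c := by
  by_contra! hlt
  obtain ⟨y, hy1, hy2⟩ := exists_between hlt
  have hx : ContinuousAt (fun p : E × ℝ × ℝ => p.2.1⁻¹ • p.1) (x, (1 : ℝ), c) := by
    refine ContinuousAt.smul (ContinuousAt.inv₀ (by fun_prop) ?_) (by fun_prop)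
    simp
  have hc : ContinuousAt (fun p : E × ℝ × ℝ => ((p.2.2 / p.2.1 : ℝ) : EReal)) (x, (1 : ℝ), c) := by
    refine continuous_coe_real_ereal.continuousAt.comp ?_
    exact ContinuousAt.div (by fun_prop) (by fun_prop) (by simp)
  have h1 : ∀ᶠ p in 𝓝 (x, (1 : ℝ), c), y < g (p.2.1⁻¹ • p.1) :=
    hx.eventually (hg _ y (by simpa using hy2))
  have h2 : ∀ᶠ p in 𝓝 (x, (1 : ℝ), c), ((p.2.2 / p.2.1 : ℝ) : EReal) < y :=
    hc.eventually_lt_const (by simpa using hy1)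
  obtain ⟨p, ⟨_, hp⟩, hp1, hp2⟩ :=
    ((mem_closure_iff_frequently.1 h).and_eventually (h1.and h2)).exists
  exact absurd (hp1.trans_le (hp.trans hp2.le)) (lt_irrefl _)

/-- The slice of the closed perspective cone at height zero is the zero sublevel set of the
horizon function. -/
theorem mem_closure_perspCone_zero_iff {x : E} :
    (x, (0 : ℝ), (0 : ℝ)) ∈ closure (perspCone g) ↔ hor g x ≤ 0 := by
  constructor
  · intro h
    refine iSup₂_le fun δ hδ => le_of_forall_gt fun c hc => ?_
    obtain ⟨ε, hε, hεc⟩ := EReal.lt_iff_exists_real_btwn.1 hc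
    have hε' : 0 < ε := by exact_mod_cast hε
    have hball : ∀ᶠ p in 𝓝 (x, (0 : ℝ), (0 : ℝ)), dist p (x, (0 : ℝ), (0 : ℝ)) < min δ ε :=
      Metric.ball_mem_nhds _ (lt_min hδ hε')
    obtain ⟨⟨w, l, r⟩, ⟨hl, hp⟩, hd⟩ :=
      ((mem_closure_iff_frequently.1 h).and_eventually hball).exists
    simp only [Prod.dist_eq, max_lt_iff, Real.dist_eq, sub_zero, lt_min_iff]
      at hd hl hp
    obtain ⟨⟨hw, hlδ, _⟩, _, _, hr⟩ := hd
    refine lt_of_le_of_lt ?_ hεc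
    refine (iInf₂_le l ⟨hl, (le_abs_self l).trans_lt hlδ⟩).trans
      ((iInf₂_le w (Metric.mem_closedBall.2 hw.le)).trans ?_)
    exact ((EReal.le_coe_div_iff hl _).1 hp).trans
      (EReal.coe_le_coe_iff.2 ((le_abs_self r).trans hr.le))
  · intro h
    refine Metric.mem_closure_iff.2 fun ε hε => ?_
    have hδ : 0 < ε / 2 := by positivity
    have h1 := (iSup₂_le_iff.1 h (ε / 2) hδ).trans_lt
      (show (0 : EReal) < ((ε / 2 : ℝ) : EReal) by exact_mod_cast hδ)
    simp only [iInf_lt_iff] at h1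
    obtain ⟨l, ⟨hl0, hl⟩, w, hw, hlt⟩ := h1
    refine ⟨(w, l, ε / 2), ⟨hl0, (EReal.le_coe_div_iff hl0 _).2 hlt.le⟩, ?_⟩
    rw [Metric.mem_closedBall, dist_comm] at hw
    simp only [Prod.dist_eq, max_lt_iff, Real.dist_eq, zero_sub, abs_neg, abs_of_pos hl0,
      abs_of_pos hδ]
    exact ⟨by linarith, by linarith, by linarith⟩

end PerspCone

/-- existence of optimal solutions for convex normal integrands when
the set {x ∈ N : h^∞(x) ≤ 0 a.s.} is a linear subspace of the adapted strategies. -/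
theorem existence_convex
    {Ω : Type*} {m0 : MeasurableSpace Ω} (μ : Measure Ω) [IsProbabilityMeasure μ]
    (hcomp : μ.IsComplete)
    (T : ℕ) (n : Fin (T+1) → ℕ)
    (F : Fin (T+1) → MeasurableSpace Ω)
    (hFmono : ∀ s t : Fin (T+1), s ≤ t → F s ≤ F t) (hFle : ∀ t, F t ≤ m0)
    -- h : an F-normal integrand bounded below by an integrable m, a.s. convex
    (h : Strat T n → Ω → EReal)
    (hmeas : Measurable fun p : Strat T n × Ω => h p.1 p.2)
    (hlsc : ∀ ω, LowerSemicontinuous fun x => h x ω)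
    (m : Ω → ℝ) (hm : Integrable m μ) (hbd : ∀ x ω, (m ω : EReal) ≤ h x ω)
    (hcvx : ∀ᵐ ω ∂μ, EConvexOn fun x => h x ω)
    -- {x ∈ N : h^∞(x) ≤ 0 a.s.} is a linear subspace of the adapted strategies
    (hzero : ∀ᵐ ω ∂μ, hor (fun z => h z ω) (0 : Strat T n) ≤ 0)
    (hadd : ∀ x y : (t : Fin (T+1)) → Ω → Fin (n t) → ℝ,
      (∀ t, Measurable[F t] (x t)) → (∀ t, Measurable[F t] (y t)) →
      (∀ᵐ ω ∂μ, hor (fun z => h z ω) (fun s => x s ω) ≤ 0) →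
      (∀ᵐ ω ∂μ, hor (fun z => h z ω) (fun s => y s ω) ≤ 0) →
      ∀ᵐ ω ∂μ, hor (fun z => h z ω) (fun s => x s ω + y s ω) ≤ 0)
    (hsmul : ∀ x : (t : Fin (T+1)) → Ω → Fin (n t) → ℝ, (∀ t, Measurable[F t] (x t)) →
      (∀ᵐ ω ∂μ, hor (fun z => h z ω) (fun s => x s ω) ≤ 0) → ∀ a : ℝ,
      ∀ᵐ ω ∂μ, hor (fun z => h z ω) (fun s => a • x s ω) ≤ 0) :
    -- conclusion: an optimal adapted strategy exists
    ∃ x : (t : Fin (T+1)) → Ω → Fin (n t) → ℝ, (∀ t, Measurable[F t] (x t)) ∧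
      eInt μ (fun ω => h (fun t => x t ω) ω)
        = ⨅ (x' : (t : Fin (T+1)) → Ω → Fin (n t) → ℝ)
            (_ : ∀ t, Measurable[F t] (x' t)),
            eInt μ (fun ω => h (fun t => x' t ω) ω) := by
  classical
  set V : EReal := ⨅ (x' : (t : Fin (T+1)) → Ω → Fin (n t) → ℝ) (_ : ∀ t, Measurable[F t] (x' t)),
    eInt μ (fun ω => h (fun t => x' t ω) ω) with hV
  have hVle : ∀ x : (t : Fin (T+1)) → Ω → Fin (n t) → ℝ, (∀ t, Measurable[F t] (x t)) →
      V ≤ eInt μ (fun ω => h (fun t => x t ω) ω) := fun x hx => iInf₂_le x hx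
  by_cases hVtop : V = ⊤
  · have h0 : ∀ t, Measurable[F t] fun _ : Ω => (0 : Fin (n t) → ℝ) := fun t => measurable_const
    exact ⟨fun t _ => 0, h0, (hVtop ▸ le_top).antisymm (hVle _ h0)⟩
  have hVbot : V ≠ ⊥ := by
    have : ((∫ ω, m ω ∂μ : ℝ) : EReal) ≤ V := by
      rw [← eInt_coe hm]
      exact le_iInf₂ fun x _ => eInt_mono_ae (.of_forall fun ω => hbd _ ω)
    exact ((EReal.bot_lt_coe _).trans_le this).ne'
  lift V to ℝ using ⟨hVtop, hVbot⟩ with a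
  have hHmeas : ∀ x : (t : Fin (T+1)) → Ω → Fin (n t) → ℝ, (∀ t, Measurable[F t] (x t)) →
      Measurable fun ω => h (fun t => x t ω) ω := fun x hx =>
    hmeas.comp ((measurable_pi_lambda _ fun t => (hx t).mono (hFle t) le_rfl).prodMk measurable_id)
  -- integrable upper bounds of the cost of some adapted strategy
  let C : ℕ → Set (Ω → ℝ) := fun k => {f | Integrable f μ ∧ ∫ ω, f ω ∂μ ≤ a + 1 / ((k : ℝ) + 1) ∧
    ∃ x : (t : Fin (T+1)) → Ω → Fin (n t) → ℝ, (∀ t, Measurable[F t] (x t)) ∧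
      ∀ᵐ ω ∂μ, h (fun t => x t ω) ω ≤ f ω}
  obtain ⟨g, hgC, G, hG, hgG, hGle⟩ := exists_ae_tendsto_of_midpoint_closed (C := C) hm
    (α := fun k : ℕ => a + 1 / ((k : ℝ) + 1)) (a := a)
    (by
      rintro k j hkj f ⟨h1, h2, h3⟩
      have : 1 / ((j : ℝ) + 1) ≤ 1 / ((k : ℝ) + 1) :=
        one_div_le_one_div_of_le (by positivity) (by exact_mod_cast Nat.succ_le_succ hkj)
      exact ⟨h1, by linarith, h3⟩)
    (by
      intro k
      have hlt : (a : EReal) < ((a + 1 / ((k : ℝ) + 1) : ℝ) : EReal) :=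
        EReal.coe_lt_coe_iff.2 (lt_add_of_pos_right _ (by positivity))
      rw [hV] at hlt
      simp only [iInf_lt_iff] at hlt
      obtain ⟨x, hx, hlt⟩ := hlt
      obtain ⟨f, hf, hfe⟩ := exists_integrable_of_eInt_lt_top (hHmeas x hx) hm
        (fun ω => hbd _ ω) (hlt.trans (EReal.coe_lt_top _))
      refine ⟨f, hf, ?_, x, hx, hfe.le⟩
      have := (eInt_mono_ae hfe.symm.le).trans_lt hlt
      rw [eInt_coe hf] at this
      exact (EReal.coe_lt_coe_iff.1 this).le)
    (by
      rintro k f ⟨hf, hf', x, hx, hxf⟩ g ⟨hg, hg', y, hy, hyg⟩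
      refine ⟨(hf.add hg).div_const 2, ?_, fun t ω => (1 / 2 : ℝ) • x t ω + (1 / 2 : ℝ) • y t ω,
        fun t => ((hx t).const_smul (1 / 2 : ℝ)).add ((hy t).const_smul (1 / 2 : ℝ)), ?_⟩
      · rw [integral_div, integral_add hf hg]
        linarith
      · filter_upwards [hxf, hyg, hcvx] with ω h1 h2 h3
        have hhalf : (0 : EReal) ≤ ((1 / 2 : ℝ) : EReal) := EReal.coe_nonneg.2 (by norm_num)
        refine (h3 (fun t => x t ω) (fun t => y t ω) (1 / 2) (1 / 2) (by norm_num) (by norm_num)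
          (by norm_num)).trans ((add_le_add (mul_le_mul_of_nonneg_left h1 hhalf)
            (mul_le_mul_of_nonneg_left h2 hhalf)).trans_eq ?_)
        rw [← EReal.coe_mul, ← EReal.coe_mul, ← EReal.coe_add]
        congr 1
        ring)
    (fun k f hf => hf.1)
    (by
      rintro k f ⟨_, _, x, _, hx⟩
      filter_upwards [hx] with ω hω
      exact EReal.coe_le_coe_iff.1 ((hbd _ ω).trans hω))
    (by simpa using (tendsto_one_div_add_atTop_nhds_zero_nat (𝕜 := ℝ)).const_add a)
    (fun k f hf => hf.2.1)
  choose _ _ X hX hXg using hgC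
  let c : ((Σ t, Fin (n t)) → ℝ) → Strat T n := fun v t k => v ⟨t, k⟩
  have hc : Continuous c := by fun_prop
  obtain ⟨z, hzm, _, hzK⟩ := exists_adapted_limit_aux μ (fun i : Σ t, Fin (n t) => i.1) F hFmono
    (fun ω => {p | (c p.1, p.2) ∈ closure (perspCone fun x => h x ω)})
    (fun ω => isClosed_closure.preimage ((hc.comp continuous_fst).prodMk continuous_snd))
    (fun ω r hr p hp => smul_mem_closure_perspCone hr hp)
    (by
      filter_upwards [hzero] with ω hω
      exact mem_closure_perspCone_zero_iff.2 hω)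
    (by
      filter_upwards [hcvx] with ω hω p hp q hq
      exact hω.add_mem_closure_perspCone hp hq)
    (by
      intro x hx hxK
      have := hsmul (fun t ω k => x ⟨t, k⟩ ω) (fun t => measurable_pi_of_forall fun k => hx ⟨t, k⟩)
        (by
          filter_upwards [hxK] with ω hω
          exact mem_closure_perspCone_zero_iff.1 hω) (-1)
      filter_upwards [this] with ω hω
      have e : (fun s => (-1 : ℝ) • fun k => x ⟨s, k⟩ ω) = c fun i => -x i ω := by
        funext t k
        simp [c]
      rw [e] at hω
      exact mem_closure_perspCone_zero_iff.2 hω)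
    Finset.univ (fun k i ω => X k i.1 ω i.2) (fun k ω => (1, g k ω)) 0 (fun ω => (1, G ω))
    (fun k i _ => (measurable_pi_apply i.2).comp (hX k i.1))
    (by simp)
    (by
      filter_upwards [hgG] with ω hω
      exact tendsto_const_nhds.prodMk_nhds hω)
    (by
      intro k
      filter_upwards [hXg k] with ω hω
      refine subset_closure ⟨one_pos, ?_⟩
      simpa [c] using hω)
  have hz : ∀ t, Measurable[F t] fun ω (k : Fin (n t)) => z ⟨t, k⟩ ω := fun t =>
    measurable_pi_of_forall fun k => hzm ⟨t, k⟩ (Finset.mem_univ _)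
  refine ⟨fun t ω k => z ⟨t, k⟩ ω, hz, le_antisymm ?_ (hVle _ hz)⟩
  have hzle : ∀ᵐ ω ∂μ, h (fun t k => z ⟨t, k⟩ ω) ω ≤ (G ω : EReal) := by
    filter_upwards [hzK] with ω hω
    exact (hlsc ω).le_of_mem_closure_perspCone hω
  refine (eInt_mono_ae hzle).trans ?_
  rw [eInt_coe hG]
  exact EReal.coe_le_coe_iff.2 hGle

end
end

section
/- Let V : ℝ^{T+1} → (−∞,+∞] be lower semicontinuous with V(0) = 0, nondecreasing in the sense that d¹ − d² ∈ ℝ^{T+1}_− implies V(d¹) ≤ V(d²), and suppose its horizon function satisfies V^∞ = δ_{ℝ^{T+1}_−} (the indicator function of the nonpositive orthant). Then V satisfies condition (w) with base point 0, i.e., V^∞(d) = liminf_{α→+∞} V(αd)/α for every d ∈ ℝ^{T+1}; in particular V^∞(d) ≤ 0 if and only if d ∈ ℝ^{T+1}_−. -/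
open Filter MeasureTheory Metric Set
open scoped Topology ENNReal

attribute [local instance] Classical.propDecidable

noncomputable section

/-- The horizon function is bounded above by the lower limit of the difference quotients along
each ray from the origin. -/
theorem hor_le_liminf {E : Type*} [SeminormedAddCommGroup E] [NormedSpace ℝ E]
    (g : E → EReal) (w : E) :
    hor g w ≤ Filter.liminf (fun α : ℝ => ((α⁻¹ : ℝ) : EReal) * g (α • w)) Filter.atTop := by
  refine iSup₂_le fun δ hδ => Filter.le_liminf_of_le (h := ?_)
  filter_upwards [Filter.eventually_gt_atTop δ⁻¹] with α hα
  have hα0 : 0 < α := (inv_pos.2 hδ).trans hα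
  have hw : α⁻¹ ∈ Set.Ioo (0 : ℝ) δ := ⟨inv_pos.2 hα0, inv_lt_of_inv_lt₀ hδ hα⟩
  refine (iInf₂_le α⁻¹ hw).trans ((iInf₂_le w (Metric.mem_closedBall_self hδ.le)).trans ?_)
  rw [inv_inv]

/-- a nondecreasing lsc disutility with V(0) = 0 whose horizon function
is the indicator of the nonpositive orthant satisfies condition (w) with base point 0,
and its horizon function is nonpositive exactly on the nonpositive orthant. -/
theorem condW_of_inada {T : ℕ} (V : (Fin (T+1) → ℝ) → EReal)
    (hlsc : LowerSemicontinuous V) (hV0 : V 0 = 0)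
    (hmono : ∀ d₁ d₂ : Fin (T+1) → ℝ, (∀ i, d₁ i ≤ d₂ i) → V d₁ ≤ V d₂)
    (hinada : ∀ d : Fin (T+1) → ℝ, hor V d = if ∀ i, d i ≤ 0 then (0 : EReal) else ⊤) :
    (∀ d : Fin (T+1) → ℝ,
      hor V d = Filter.liminf (fun α : ℝ => ((α⁻¹ : ℝ) : EReal) * V (α • d)) Filter.atTop) ∧
    (∀ d : Fin (T+1) → ℝ, hor V d ≤ 0 ↔ ∀ i, d i ≤ 0) := by
  refine ⟨fun d => le_antisymm (hor_le_liminf V d) ?_, fun d => ?_⟩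
  · rw [hinada]
    split_ifs with hd
    · refine Filter.liminf_le_of_frequently_le' (Filter.Eventually.frequently ?_)
      filter_upwards [Filter.eventually_gt_atTop (0 : ℝ)] with α hα
      have hV : V (α • d) ≤ 0 := hV0 ▸ hmono _ _ fun i =>
        mul_nonpos_of_nonneg_of_nonpos hα.le (hd i)
      exact mul_nonpos_of_nonneg_of_nonpos
        (EReal.coe_nonneg.2 (inv_nonneg.2 hα.le)) hV
    · exact le_top
  · rw [hinada]
    split_ifs with hd <;> simp [hd]

end
end

section
/- Let T ≥ 0, J ≥ 1, and for each t = 0,…,T let H_t : ℝ^J → [0,+∞] satisfy H_t(z̃) > 0 for every z̃ ∉ ℝ^J_−. Suppose z = (z_t)_{t=0}^T with z_t = (z_t^0, z̃_t) ∈ ℝ × ℝ^J satisfies z_{−1} := 0, z_T = 0, and Δz_t^0 + H_t(Δz̃_t) ≤ 0 for every t = 0,…,T, where Δz_t = z_t − z_{t−1}. Then z_t = 0 for every t. (Consequently, in a market model with a perfectly liquid cash account, costs S_t(z,ω) = z^0 + S̃_t(z̃,ω) and liquidation constraint at time T, the conditions S̃_t^∞ ≥ 0 and S̃_t^∞(z̃)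 > 0 for all z̃ ∉ ℝ^J_− imply that the set of adapted processes z with Δz^0 + S̃^∞(Δz̃) ≤ 0 and z_T = 0 reduces to {0}.) -/
open Filter Set
open scoped Topology ENNReal

attribute [local instance] Classical.propDecidable

noncomputable section

/-- A real sequence starting at a nonpositive value, with nonpositive increments up to time `T`,
that vanishes at `T` vanishes at every earlier time. -/
theorem eq_zero_of_increments_nonpos {T : ℕ} {a : ℕ → ℝ} (haT : a T = 0) (h0 : a 0 ≤ 0)
    (hstep : ∀ t < T, a (t + 1) ≤ a t) : ∀ t ≤ T, a t = 0 := by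
  intro t ht
  have hle : ∀ s ≤ T, a s ≤ 0 := by
    intro s
    induction s with
    | zero => exact fun _ => h0
    | succ n ih => exact fun hn => (hstep n hn).trans (ih (by omega))
  have hge : 0 ≤ a t := by
    induction ht using Nat.decreasingInduction with
    | self => exact haT.ge
    | of_succ n hn ih => exact ih.trans (hstep n hn)
  exact le_antisymm (hle t ht) hge

/-- A nonpositive sum of a real number and a nonnegative extended real has a nonpositive real
summand. -/
theorem nonpos_of_coe_add_coe_ennreal_nonpos {x : ℝ} {y : ℝ≥0∞}
    (h : (x : EReal) + (y : EReal) ≤ 0) : x ≤ 0 := by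
  have hx : (x : EReal) ≤ 0 :=
    (le_add_of_nonneg_right (EReal.coe_ennreal_nonneg y)).trans h
  exact_mod_cast hx

/-- in a model with a perfectly liquid cash account, if the horizon
costs H_t are nonnegative and strictly positive off the nonpositive orthant, then the
only self-financing liquidating strategy with nonpositive total expenditures is 0. -/
theorem cash_account_linearity (T J : ℕ)
    (H : ℕ → (Fin J → ℝ) → ℝ≥0∞)
    (hHpos : ∀ t ≤ T, ∀ zt : Fin J → ℝ, ¬(∀ i, zt i ≤ 0) → 0 < H t zt)
    (z : ℕ → ℝ × (Fin J → ℝ))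
    (hzT : z T = 0)
    (hbudget : ∀ t ≤ T,
      (((if t = 0 then z 0 else z t - z (t-1)).1 : ℝ) : EReal)
        + ((H t (if t = 0 then z 0 else z t - z (t-1)).2 : ℝ≥0∞) : EReal) ≤ 0) :
    ∀ t ≤ T, z t = 0 := by
  have hcash : ∀ t ≤ T, (z t).1 = 0 := by
    refine eq_zero_of_increments_nonpos (a := fun t => (z t).1) (by simp [hzT]) ?_ ?_
    · simpa using nonpos_of_coe_add_coe_ennreal_nonpos (hbudget 0 (Nat.zero_le T))
    · intro t ht
      simpa using nonpos_of_coe_add_coe_ennreal_nonpos (hbudget (t + 1) ht)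
  have hasset : ∀ t ≤ T, ∀ i, (if t = 0 then z 0 else z t - z (t-1)).2 i ≤ 0 := by
    intro t ht
    by_contra hnot
    have hpos := hHpos t ht _ hnot
    have hfst : (if t = 0 then z 0 else z t - z (t-1)).1 = 0 := by
      split_ifs
      · exact hcash 0 (Nat.zero_le T)
      · simp [hcash t ht, hcash (t - 1) (by omega)]
    have hb := hbudget t ht
    rw [hfst, EReal.coe_zero, zero_add] at hb
    exact absurd hb (not_le.mpr (EReal.coe_ennreal_pos.mpr hpos))
  intro t ht
  refine Prod.ext (hcash t ht) (funext fun i => ?_)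
  refine eq_zero_of_increments_nonpos (a := fun t => (z t).2 i) (by simp [hzT]) ?_ ?_ t ht
  · simpa using hasset 0 (Nat.zero_le T) i
  · intro t ht
    simpa using hasset (t + 1) ht i

end
end
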